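/- Let τ2 : Ω × Ω → {C,D} be a deterministic memory-two strategy of player 2, let Q : {C,D} × Ω × Ω → ℝ satisfy the player-1 memory-two Bellman optimality equation against τ2, and let τ1 : Ω × Ω → {C,D} be strictly greedy for Q. Then for every state s1, at least one of the following four alternatives holds: (a) τ1(s1,s2) = τ2(s1,s2) for all s2; (b) τ1(s1,s2) ≠ τ2(s1,s2) for all s2; (c) τ1(s1,s2) = D for all s2; (d) τ1(s1,s2) = C for all s2. -/

import Mathlib

inductive Act where
  | C : Act
  | D : Act
deriving DecidableEq

open Act

abbrev St : Type := Act × Act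

/-- Player 1's payoff in the prisoner's dilemma. -/
def r1 (R S T P : ℝ) : Act → Act → ℝ
  | C, C => R
  | C, D => S
  | D, C => T
  | D, D => P

/-- Swap the roles of the two players in a state. -/
def pi' (s : St) : St := (s.2, s.1)

/-- structure of the optimal (strictly greedy) strategy against a deterministic
memory-two strategy: for each last state `s1`, one of four alternatives holds. -/
theorem stmt_1 (R S T P γ : ℝ) (hTR : T > R) (hRP : R > P) (hPS : P > S)
    (h2R : 2 * R > T + S) (hγ0 : 0 ≤ γ) (hγ1 : γ < 1)
    (τ2 : St → St → Act) (Q : Act → St → St → ℝ)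
    (hQ : ∀ σ s1 s2, Q σ s1 s2 =
      r1 R S T P σ (τ2 s1 s2) +
        γ * max (Q C (σ, τ2 s1 s2) s1) (Q D (σ, τ2 s1 s2) s1))
    (τ1 : St → St → Act)
    (hgreedy : ∀ s1 s2, (τ1 s1 s2 = C → Q C s1 s2 > Q D s1 s2) ∧
      (τ1 s1 s2 = D → Q D s1 s2 > Q C s1 s2)) :
    ∀ s1 : St, (∀ s2, τ1 s1 s2 = τ2 s1 s2) ∨ (∀ s2, τ1 s1 s2 ≠ τ2 s1 s2) ∨
      (∀ s2, τ1 s1 s2 = D) ∨ (∀ s2, τ1 s1 s2 = C) := by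
  intro s1
  have factors : Function.FactorsThrough (τ1 s1) (τ2 s1) := by
    intro a b hab
    have hQab : ∀ σ, Q σ s1 a = Q σ s1 b := fun σ => by
      rw [hQ σ s1 a, hQ σ s1 b, hab]
    have ha := hgreedy s1 a
    have hb := hgreedy s1 b
    rw [hQab, hQab] at ha
    cases h : τ1 s1 a <;> cases h' : τ1 s1 b
    · rfl
    · exact absurd (ha.1 h) (hb.2 h').not_gt
    · exact absurd (ha.2 h) (hb.1 h').not_gt
    · rfl
  have : Nonempty Act := ⟨C⟩
  obtain ⟨f, hf⟩ := (Function.factorsThrough_iff _).1 factors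
  have hf' : ∀ s2, τ1 s1 s2 = f (τ2 s1 s2) := congrFun hf
  simp only [hf']
  cases hC : f C <;> cases hD : f D
  · exact .inr (.inr (.inr fun s2 => by cases τ2 s1 s2 <;> assumption))
  · exact .inl fun s2 => by cases τ2 s1 s2 <;> assumption
  · exact .inr (.inl fun s2 => by cases τ2 s1 s2 <;> simp [hC, hD])
  · exact .inr (.inr (.inl fun s2 => by cases τ2 s1 s2 <;> assumption))
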